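/- arXiv:1505.01555 — 3 statements merged into one kernel-verified Lean document; each statement's English description precedes it below -/
import Mathlib

section
/- Let t, s be real numbers with t ≠ s and set T = t - s. Define the power series f(a) = t - T·∑_{n=1}^∞ (L_n'(nT)/n)·e^{-nt}·a^n, where L_n' denotes the derivative of the n-th Laguerre polynomial. Then this power series has positive radius of convergence, and for all a in some open neighborhood of 0 the sum x = f(a) satisfies x ≠ s and e^x·(x - t)/(x - s) = a. -/
open Finset

/-- The `n`-th Laguerre polynomial as a real function:
`L_n(x) = ∑_{k=0}^n C(n,k) (-x)^k / k!`. -/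
noncomputable def laguerre (n : ℕ) (x : ℝ) : ℝ :=
  ∑ k ∈ Finset.range (n + 1), (n.choose k : ℝ) * (-x) ^ k / (k.factorial : ℝ)

open Filter Topology Complex in
lemma lagrange_coeff (ψ G : ℂ → ℂ) (hψ : AnalyticAt ℂ ψ 0) (hψ0 : ψ 0 ≠ 0)
    (hG : AnalyticAt ℂ G 0) (hGh : ∀ᶠ u in 𝓝 (0:ℂ), G (u * ψ u) = u) (n : ℕ) (_hn : n ≠ 0) :
    ∃ r > 0, (∮ u in C(0, r), (u * ψ u) ^ (-(n:ℤ))) =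
      n * (iteratedDeriv n G 0 / n.factorial) * (2 * Real.pi * I) := by
  obtain ⟨F, hF, hFe⟩ := hG.exists_eq_sum_add_pow_mul (n+1)
  have e1 := hψ.eventually_analyticAt
  have e2 := hψ.continuousAt.eventually_ne hψ0
  have hc : Tendsto (fun u => u * ψ u) (𝓝 0) (𝓝 0) := by
    have : ContinuousAt (fun u => u * ψ u) 0 := continuousAt_id.mul hψ.continuousAt
    simpa [ContinuousAt] using this
  have e3 := hc.eventually hF.eventually_analyticAt
  obtain ⟨ρ, hρ, H⟩ := Metric.eventually_nhds_iff.1 (e1.and (e2.and (e3.and hGh)))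
  set r := ρ / 2 with hr
  have hr0 : 0 < r := by positivity
  have H' : ∀ u ∈ Metric.closedBall (0:ℂ) r, _ := fun u hu =>
    H (y := u) (lt_of_le_of_lt (Metric.mem_closedBall.1 hu) (by linarith))
  clear_value r
  refine ⟨r, hr0, ?_⟩
  set g : ℕ → ℂ := fun i => iteratedDeriv i G 0 / i.factorial with hg
  change _ = n * g n * _
  have hGs : ∀ z, G z = ∑ i ∈ range n, g i * z ^ i + g n * z ^ n + z ^ (n+1) * F z := by
    intro z
    rw [hFe z, sum_range_succ]
    simp only [smul_eq_mul, hg]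
    congr 2
    · exact sum_congr rfl fun i _ => by ring
    · ring
  set h' : ℂ → ℂ := fun u => ψ u + u * deriv ψ u with hh'
  set A : ℂ → ℂ := fun u => n * (F (u * ψ u) * h' u) + n * g n * (deriv ψ u / ψ u) with hA
  have hAd : ∀ u ∈ Metric.closedBall (0:ℂ) r, DifferentiableAt ℂ A u := by
    intro u hu
    obtain ⟨h1, h2, h3, h4⟩ := H' u hu
    have d1 := h1.differentiableAt
    have d2 := h1.deriv.differentiableAt
    have d3 : DifferentiableAt ℂ (fun u => F (u * ψ u)) u :=
      DifferentiableAt.comp u h3.differentiableAt (differentiableAt_id.mul d1)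
    have d4 : DifferentiableAt ℂ h' u := d1.add (differentiableAt_id.mul d2)
    exact ((d3.mul d4).const_mul _).add ((d2.div d1 h2).const_mul _)
  have hA0 : (∮ u in C(0, r), A u) = 0 :=
    circleIntegral_eq_zero_of_differentiable_on_off_countable hr0.le Set.countable_empty
      (fun u hu => (hAd u hu).continuousAt.continuousWithinAt)
      (fun u hu => hAd u (Metric.ball_subset_closedBall hu.1))
  have hsph : ∀ u ∈ Metric.sphere (0:ℂ) r, u ≠ 0 := by
    rintro u hu rfl
    simp at hu; linarith
  have hDer : ∀ u ∈ Metric.sphere (0:ℂ) r, HasDerivAt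
      (fun u => u * (u * ψ u) ^ (-(n:ℤ)) +
        n * ∑ i ∈ range n, g i / ((i:ℂ) - n) * (u * ψ u) ^ ((i:ℤ) - n))
      ((u * ψ u) ^ (-(n:ℤ)) - n * g n * u⁻¹ - A u) u := by
    intro u hu
    obtain ⟨h1, h2, h3, h4⟩ := H' u (Metric.sphere_subset_closedBall hu)
    have hu0 := hsph u hu
    have hne : u * ψ u ≠ 0 := mul_ne_zero hu0 h2
    have dh : HasDerivAt (fun u => u * ψ u) (h' u) u := by
      refine ((hasDerivAt_id u).fun_mul h1.differentiableAt.hasDerivAt).congr_deriv ?_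
      simp [h']
    have dz : ∀ m : ℤ, HasDerivAt (fun u => (u * ψ u) ^ m)
        (m * (u * ψ u) ^ (m - 1) * h' u) u := fun m =>
      HasDerivAt.comp u (h₂ := fun z => z ^ m) (hasDerivAt_zpow m (u * ψ u) (Or.inl hne)) dh
    have D := ((hasDerivAt_id u).mul (dz (-(n:ℤ)))).add
      ((HasDerivAt.fun_sum (u := range n) fun i _ =>
        (dz ((i:ℤ) - n)).const_mul (g i / ((i:ℂ) - n))).const_mul (n:ℂ))
    refine D.congr_deriv ?_
    have key := hGs (u * ψ u)
    rw [h4] at key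
    have hs : ∑ i ∈ range n, g i / ((i:ℂ) - n) *
        ((((i:ℤ) - n : ℤ) : ℂ) * (u * ψ u) ^ ((i:ℤ) - n - 1) * h' u) =
        (u * ψ u) ^ (-(n:ℤ) - 1) * h' u * ∑ i ∈ range n, g i * (u * ψ u) ^ i := by
      rw [mul_sum]
      refine sum_congr rfl fun i hi => ?_
      have : ((i:ℂ) - n) ≠ 0 := by
        rw [sub_ne_zero]; exact_mod_cast (mem_range.1 hi).ne
      have e : (u * ψ u) ^ ((i:ℤ) - n - 1) = (u * ψ u) ^ (-(n:ℤ) - 1) * (u * ψ u) ^ i := by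
        rw [← zpow_natCast, ← zpow_add₀ hne]; congr 1; ring
      rw [e]; push_cast; field_simp
    rw [hs]
    have hs2 : ∑ i ∈ range n, g i * (u * ψ u) ^ i =
      u - g n * (u * ψ u) ^ n - (u * ψ u) ^ (n+1) * F (u * ψ u) := by
        linear_combination - key
    rw [hs2]
    have z1 : (u * ψ u) ^ (-(n:ℤ) - 1) * (u * ψ u) ^ (n+1) = 1 := by
      rw [← zpow_natCast, ← zpow_add₀ hne]; simp
    have z2 : (u * ψ u) ^ (-(n:ℤ) - 1) * (u * ψ u) ^ n = (u * ψ u)⁻¹ := by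
      rw [← zpow_natCast, ← zpow_add₀ hne, ← zpow_neg_one]; congr 1; ring
    have z3 : (u * ψ u)⁻¹ * h' u = u⁻¹ + deriv ψ u / ψ u := by
      simp only [hh']; field_simp
    simp only [hA, id]
    push_cast
    linear_combination (-(n:ℂ)) * g n * h' u * z2 - n * h' u * F (u * ψ u) * z1 - n * g n * z3
  have hI := circleIntegral.integral_eq_zero_of_hasDerivWithinAt hr0.le
    (fun u hu => (hDer u hu).hasDerivWithinAt)
  have c1 : CircleIntegrable (fun u => (u * ψ u) ^ (-(n:ℤ))) 0 r := by
    refine ContinuousOn.circleIntegrable hr0.le fun u hu => ?_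
    obtain ⟨h1, h2, h3, h4⟩ := H' u (Metric.sphere_subset_closedBall hu)
    exact ((continuousAt_id.mul h1.continuousAt).zpow₀ _
      (Or.inl (mul_ne_zero (hsph u hu) h2))).continuousWithinAt
  have c2 : CircleIntegrable (fun u => n * g n * u⁻¹) 0 r := by
    refine ContinuousOn.circleIntegrable hr0.le fun u hu => ?_
    exact (continuousAt_const.mul (continuousAt_inv₀ (hsph u hu))).continuousWithinAt
  have c3 : CircleIntegrable A 0 r := by
    refine ContinuousOn.circleIntegrable hr0.le fun u hu => ?_
    exact (hAd u (Metric.sphere_subset_closedBall hu)).continuousAt.continuousWithinAt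
  have hinv := circleIntegral.integral_sub_center_inv 0 hr0.ne'
  simp only [sub_zero] at hinv
  rw [circleIntegral.integral_sub (f := fun u => (u * ψ u) ^ (-(n:ℤ)) - n * g n * u⁻¹)
      (c1.sub c2) c3, circleIntegral.integral_sub c1 c2, hA0,
    circleIntegral.integral_const_mul, hinv] at hI
  linear_combination hI

open Complex in
lemma coeff_integral (t T : ℂ) (n : ℕ) (r : ℝ) (hr : 0 < r) :
    (∮ u in C(0, r), (u * (exp (t + u) / (u + T))) ^ (-(n:ℤ))) =
      exp (-n * t) * (∑ k ∈ range n, (n.choose (k+1) : ℂ) * T ^ (k+1) * (-n) ^ k / k.factorial)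
        * (2 * Real.pi * I) := by
  have hsph : ∀ u ∈ Metric.sphere (0:ℂ) r, u ≠ 0 := by
    rintro u hu rfl
    simp at hu; linarith
  have h1 : Set.EqOn (fun u => (u * (exp (t + u) / (u + T))) ^ (-(n:ℤ)))
      (fun u => ∑ m ∈ range (n+1), (exp (-n * t) * T ^ (n-m) * n.choose m) *
        (exp (-n * u) * u ^ m / u ^ n)) (Metric.sphere 0 r) := by
    intro u hu
    have hu0 := hsph u hu
    have e : exp (-n * t) * exp (-n * u) = (exp (t + u) ^ n)⁻¹ := by
      rw [← exp_add, ← exp_nat_mul, ← exp_neg]; congr 1; ring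
    simp only
    rw [zpow_neg, zpow_natCast, mul_pow, div_pow, add_pow]
    rw [mul_inv, inv_div, div_eq_mul_inv, ← e, sum_mul, mul_sum]
    refine sum_congr rfl fun m _ => ?_
    field_simp
  rw [circleIntegral.integral_congr hr.le h1, circleIntegral.integral_fun_sum]
  · simp only [circleIntegral.integral_const_mul]
    rw [sum_range_succ, mul_sum, sum_mul, ← sum_range_reflect (n := n)]
    have hd : Differentiable ℂ (fun u : ℂ => exp (-n * u)) := by fun_prop
    have hl : (∮ u in C(0, r), exp (-n * u) * u ^ n / u ^ n) = 0 := by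
      rw [circleIntegral.integral_congr (g := fun u => exp (-n * u)) hr.le]
      · exact circleIntegral_eq_zero_of_differentiable_on_off_countable hr.le Set.countable_empty
          hd.continuous.continuousOn (fun u _ => hd u)
      · intro u hu
        have hu0 := hsph u hu
        simp only; field_simp
    rw [hl, mul_zero, add_zero]
    refine sum_congr rfl fun k hk => ?_
    have hk := mem_range.1 hk
    have hi : (∮ u in C(0, r), exp (-n * u) * u ^ (n - 1 - k) / u ^ n) =
        (2 * Real.pi * I / k.factorial) * (-n) ^ k := by
      have := hd.differentiableOn.circleIntegral_one_div_sub_center_pow_smul (c := 0) hr k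
      rw [iteratedDeriv_cexp_const_mul] at this
      simp only [smul_eq_mul, mul_zero, exp_zero, mul_one, sub_zero] at this
      rw [← this]
      refine circleIntegral.integral_congr hr.le fun u hu => ?_
      have hu0 := hsph u hu
      have : u ^ n = u ^ (n - 1 - k) * u ^ (k+1) := by rw [← pow_add]; congr 1; omega
      simp only [this]; field_simp
    rw [hi]
    have e1 : n - (n - 1 - k) = k + 1 := by omega
    have e2 : n.choose (n - 1 - k) = n.choose (k+1) := by
      rw [← Nat.choose_symm (by omega : k + 1 ≤ n)]; congr 1; omega
    rw [e1, e2]; ring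
  · intro m _
    refine ContinuousOn.circleIntegrable hr.le fun u hu => ?_
    have : ContinuousAt (fun u : ℂ => exp (-n * u) * u ^ m / u ^ n) u :=
      ContinuousAt.div (by fun_prop) (by fun_prop) (pow_ne_zero _ (hsph u hu))
    exact (continuousAt_const.mul this).continuousWithinAt

lemma laguerre_deriv (n : ℕ) (T : ℝ) : -T * deriv (laguerre n) (n * T) =
    ∑ k ∈ range n, (n.choose (k+1) : ℝ) * T ^ (k+1) * (-n) ^ k / k.factorial := by
  have hd : ∀ x, HasDerivAt (laguerre n) (∑ k ∈ Finset.range (n + 1),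
      (n.choose k : ℝ) * (k * (-x) ^ (k-1) * (-1)) / (k.factorial : ℝ)) x := by
    intro x
    unfold laguerre
    refine HasDerivAt.fun_sum fun k _ => ?_
    have := ((hasDerivAt_neg x).fun_pow k)
    exact (this.const_mul _).div_const _
  rw [(hd _).deriv, sum_range_succ']
  simp only [mul_add, mul_sum]
  simp only [Nat.cast_zero, zero_mul, mul_zero, zero_div, add_zero]
  refine sum_congr rfl fun k _ => ?_
  have := Nat.factorial_ne_zero k
  rw [Nat.factorial_succ, Nat.add_sub_cancel]
  push_cast
  have h2 : (k:ℝ) + 1 ≠ 0 := by positivity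
  field_simp
  ring

open Filter Topology Complex in
/-- Taylor series of the generalized Lambert function `W(t;s;a)` around `a = 0`:
`W(t;s;a) = t - T ∑_{n≥1} (L_n'(nT)/n) e^{-nt} a^n` where `T = t - s`. The series has
positive radius of convergence and its sum `x` solves `e^x (x - t)/(x - s) = a`. -/
theorem genLambert_one_upper_one_lower_taylor (t s : ℝ) (hts : t ≠ s) :
    ∃ ε > 0, ∀ a : ℝ, |a| < ε →
      ∃ x : ℝ,
        HasSum (fun n : ℕ =>
          if n = 0 then t
          else -(t - s) * (deriv (laguerre n) ((n : ℝ) * (t - s)) / (n : ℝ)) *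
            Real.exp (-(n : ℝ) * t) * a ^ n) x ∧
        x ≠ s ∧ Real.exp x * (x - t) / (x - s) = a := by
  obtain ⟨T, hT⟩ : ∃ T, T = t - s := ⟨_, rfl⟩
  rw [← hT]
  have hT0 : T ≠ 0 := by rw [hT]; exact sub_ne_zero.2 hts
  have hTc : (T:ℂ) ≠ 0 := by exact_mod_cast hT0
  set ψ : ℂ → ℂ := fun u => exp (t + u) / (u + T) with hψd
  have hψ : AnalyticAt ℂ ψ 0 := by
    apply AnalyticAt.div
    · fun_prop
    · fun_prop
    · simpa using hTc
  have hψ0 : ψ 0 ≠ 0 := by simp [ψ, hTc]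
  set h : ℂ → ℂ := fun u => u * ψ u with hh
  have hha : AnalyticAt ℂ h 0 := analyticAt_id.mul hψ
  have hhd : deriv h 0 ≠ 0 := by
    have : HasDerivAt h (ψ 0) 0 := by
      refine ((hasDerivAt_id (0:ℂ)).fun_mul hψ.differentiableAt.hasDerivAt).congr_deriv ?_
      simp
    rwa [this.deriv]
  have hh0 : h 0 = 0 := by simp [h]
  set G := hha.hasStrictDerivAt.localInverse _ _ _ hhd with hGd
  have hG : AnalyticAt ℂ G 0 := by simpa [hh0] using hha.analyticAt_localInverse hhd
  have hl : ∀ᶠ u in 𝓝 (0:ℂ), G (h u) = u := HasStrictDerivAt.eventually_left_inverse ..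
  have hr : ∀ᶠ a in 𝓝 (0:ℂ), h (G a) = a := by
    have : ∀ᶠ a in 𝓝 (h 0), h (G a) = a := HasStrictDerivAt.eventually_right_inverse ..
    rwa [hh0] at this
  have hG0 : G 0 = 0 := by simpa [hh0] using hl.self_of_nhds
  clear_value G
  have hne : ∀ᶠ a in 𝓝 (0:ℂ), G a ≠ -T :=
    hG.continuousAt.eventually_ne (by rw [hG0]; simpa using hT0)
  have hs := hasFPowerSeriesAt_iff.1 hG.hasFPowerSeriesAt
  obtain ⟨ε, hε, H⟩ := Metric.eventually_nhds_iff.1 (hr.and (hne.and hs))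
  refine ⟨ε, hε, fun a ha => ?_⟩
  obtain ⟨h1, h2, h3⟩ := H (y := (a:ℂ)) (by simpa using ha)
  set c : ℕ → ℝ := fun n => -T * (deriv (laguerre n) ((n : ℝ) * T) / (n : ℝ)) *
            Real.exp (-(n : ℝ) * t) * a ^ n with hc
  have hcoef : ∀ n ≠ 0, ((c n : ℝ) : ℂ) = iteratedDeriv n G 0 / n.factorial * a ^ n := by
    intro n hn
    obtain ⟨r, hr, hI⟩ := lagrange_coeff ψ G hψ hψ0 hG hl n hn
    rw [coeff_integral _ _ n r hr] at hI
    have hI := mul_right_cancel₀ two_pi_I_ne_zero hI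
    have hn' : (n:ℂ) ≠ 0 := by exact_mod_cast hn
    have hL := congrArg (fun x : ℝ => (x:ℂ)) (laguerre_deriv n T)
    push_cast at hL
    rw [← hL] at hI
    simp only [hc]
    push_cast
    rw [show iteratedDeriv n G 0 / (n.factorial:ℂ) =
      (n * (iteratedDeriv n G 0 / n.factorial)) / n by field_simp, ← hI]
    field_simp
  have h4 : HasSum (fun n : ℕ => (((if n = 0 then t else c n : ℝ)) : ℂ)) (t + G a) := by
    have h0 : HasSum (fun n : ℕ => if n = 0 then (t:ℂ) else 0) t := hasSum_ite_eq 0 _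
    have h5 := h0.add h3
    rw [zero_add] at h5
    convert h5 using 1
    funext n
    by_cases hn : n = 0
    · subst hn
      simp [hG0, FormalMultilinearSeries.coeff_ofScalars]
    · simp only [hn, if_false]
      rw [hcoef n hn]
      simp [FormalMultilinearSeries.coeff_ofScalars]
      ring

  have hsum : Summable (fun n : ℕ => (if n = 0 then t else c n : ℝ)) :=
    Complex.summable_ofReal.1 h4.summable
  obtain ⟨x, hx⟩ := hsum
  have hxe : (x:ℂ) = t + G a := (Complex.hasSum_ofReal.2 hx).unique h4
  have hGx : G a = x - t := by rw [hxe]; ring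
  refine ⟨x, hx, ?_, ?_⟩
  · rintro rfl
    apply h2
    rw [hGx, hT]; push_cast; ring
  · have : ((Real.exp x * (x - t) / (x - s) : ℝ) : ℂ) = (a:ℂ) := by
      rw [← h1, hGx]
      simp only [hh, hψd, hT]
      push_cast
      rw [show (t:ℂ) + (x - t) = x by ring, show (x:ℂ) - t + (t - s) = x - s by ring]
      ring
    exact_mod_cast this
end

section
/- Let r ≠ -1 be a real number. For positive integers k < n define the polynomial value M_k^{(n)}(y) = ∑_{i=1}^k n^{(i)}·S(k,i)·(-y)^i, where n^{(i)} = n(n+1)⋯(n+i-1) is the rising factorial and S(k,i) denotes the Stirling number of the second kind. Define the power series F(x) = x/(r+1) + ∑_{n=2}^∞ M_{n-1}^{(n)}(1/(r+1))·x^n/((r+1)^n·n!). Then F has positive radius of convergence and for all x in some open neighborhood of 0, y = F(x) satisfies y·e^y + r·y = x. -/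
open Finset

/-- Stirling number of the second kind, `S(k,i) = (1/i!) ∑_{j=0}^i (-1)^j C(i,j) (i-j)^k`. -/
noncomputable def stirling2 (k i : ℕ) : ℝ :=
  (1 / (i.factorial : ℝ)) *
    ∑ j ∈ Finset.range (i + 1), (-1) ^ j * (i.choose j : ℝ) * ((i - j : ℕ) : ℝ) ^ k

/-- The polynomial `M_k^{(n)}(y) = ∑_{i=1}^k n^{(i)} S(k,i) (-y)^i`, where `n^{(i)}`
is the rising factorial `n(n+1)⋯(n+i-1)`. -/
noncomputable def M (k n : ℕ) (y : ℝ) : ℝ :=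
  ∑ i ∈ Finset.Icc 1 k, (n.ascFactorial i : ℝ) * stirling2 k i * (-y) ^ i


section Formal
open PowerSeries

lemma lag_key (h u : PowerSeries ℝ) (hu : h * u = 1) (k : ℕ) :
    coeff k (u ^ (k + 1) * (h + X * derivative ℝ h)) = if k = 0 then 1 else 0 := by
  have hd : derivative ℝ u = - u ^ 2 * derivative ℝ h := by
    have h1 : derivative ℝ (h * u) = 0 := by rw [hu]; simp
    rw [Derivation.leibniz] at h1
    simp only [smul_eq_mul] at h1
    calc derivative ℝ u = (h * u) * derivative ℝ u := by rw [hu, one_mul]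
      _ = u * (h * derivative ℝ u + u * derivative ℝ h) - u ^ 2 * derivative ℝ h := by ring
      _ = _ := by rw [h1]; ring
  rcases k with _ | k
  · simp only [zero_add, pow_one, if_true]
    have : constantCoeff (h * u) = 1 := by rw [hu]; simp
    rw [map_mul] at this
    simp only [coeff_zero_eq_constantCoeff, map_mul, map_add, constantCoeff_X, zero_mul, add_zero]
    linarith
  · have e1 : u ^ (k + 1 + 1) * (h + X * derivative ℝ h)
        = u ^ (k + 1) + X * (u ^ (k + 2) * derivative ℝ h) := by
      calc _ = u ^ (k + 1) * (h * u) + X * (u ^ (k + 2) * derivative ℝ h) := by ring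
        _ = _ := by rw [hu, mul_one]
    have e2 : derivative ℝ (u ^ (k + 1)) = - (((k : PowerSeries ℝ) + 1) * (u ^ (k + 2) * derivative ℝ h)) := by
      rw [Derivation.leibniz_pow, hd]
      simp only [Nat.add_sub_cancel, smul_eq_mul, nsmul_eq_mul]
      push_cast
      ring
    have e3 := congrArg (coeff k) e2
    rw [coeff_derivative] at e3
    have e4 : ((k : PowerSeries ℝ) + 1) = C ((k : ℝ) + 1) := by simp
    rw [e4, map_neg, coeff_C_mul] at e3
    rw [e1, map_add, coeff_succ_X_mul]
    have hk : ((k : ℝ) + 1) ≠ 0 := by positivity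
    rw [if_neg (by omega)]
    apply mul_left_cancel₀ hk
    linarith

lemma lag_formal (h u R : PowerSeries ℝ) (hu : h * u = 1) (c : ℕ → ℝ) (n : ℕ)
    (hX : X = ∑ m ∈ range (n + 2), C (c m) * (X * h) ^ m + (X * h) ^ (n + 2) * R) :
    coeff n (u ^ (n + 1)) = (n + 1) * c (n + 1) := by
  have hf : derivative ℝ (X * h) = h + X * derivative ℝ h := by
    rw [Derivation.leibniz]
    simp only [smul_eq_mul, derivative_X, mul_one]
    ring
  have h1 := congrArg (derivative ℝ) hX
  rw [derivative_X, map_add, map_sum, sum_range_succ'] at h1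
  have h2 : coeff n (u ^ (n + 1)) = coeff n (1 * u ^ (n + 1)) := by rw [one_mul]
  rw [h2, h1, add_mul, add_mul, sum_mul, map_add, map_add, map_sum]
  have h3 : coeff n (derivative ℝ ((X * h) ^ (n + 2) * R) * u ^ (n + 1)) = 0 := by
    rw [Derivation.leibniz, Derivation.leibniz_pow]
    simp only [smul_eq_mul, nsmul_eq_mul]
    have : ((X * h) ^ (n + 2) * derivative ℝ R + R * (((n + 2 : ℕ) : PowerSeries ℝ) *
        ((X * h) ^ (n + 2 - 1) * derivative ℝ (X * h)))) * u ^ (n + 1)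
        = X ^ (n + 1) * (h ^ (n + 1) * (X * h * derivative ℝ R + R * (((n + 2 : ℕ) : PowerSeries ℝ) *
         derivative ℝ (X * h))) * u ^ (n + 1)) := by
      rw [show n + 2 - 1 = n + 1 by omega]; ring
    rw [this, coeff_X_pow_mul', if_neg (by omega)]
  have h4 : ∀ m ∈ range (n + 1), coeff n (derivative ℝ (C (c (m + 1)) * (X * h) ^ (m + 1)) * u ^ (n + 1))
      = if m = n then (n + 1) * c (n + 1) else 0 := by
    intro m hm
    obtain ⟨k, rfl⟩ : ∃ k, n = m + k := ⟨n - m, by have := mem_range.1 hm; omega⟩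
    rw [Derivation.leibniz, Derivation.leibniz_pow, hf]
    simp only [smul_eq_mul, nsmul_eq_mul, derivative_C, mul_zero, add_zero, Nat.add_sub_cancel]
    have : C (c (m + 1)) * (((m + 1 : ℕ) : PowerSeries ℝ) * ((X * h) ^ m * (h + X * derivative ℝ h)))
        * u ^ (m + k + 1) = C (c (m + 1) * ((m : ℝ) + 1)) * (X ^ m * (u ^ (k + 1) * (h + X * derivative ℝ h))) := by
      have e : C ((m : ℝ) + 1) = ((m + 1 : ℕ) : PowerSeries ℝ) := by simp
      rw [map_mul, e]
      calc _ = C (c (m + 1)) * (((m + 1 : ℕ) : PowerSeries ℝ)) * (X ^ m * (u ^ (k + 1) * (h + X * derivative ℝ h))) * (h * u) ^ m := by ring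
        _ = _ := by rw [hu]; ring
    rw [this, coeff_C_mul, coeff_X_pow_mul', if_pos (by omega), Nat.add_sub_cancel_left, lag_key h u hu]
    by_cases hk : k = 0
    · subst hk; simp; ring
    · rw [if_neg hk, if_neg (by omega)]; simp
  rw [h3, sum_congr rfl h4]
  simp

lemma coeff_expm1_pow (k i : ℕ) :
    coeff k ((exp ℝ - 1) ^ i) = (i.factorial : ℝ) * stirling2 k i / k.factorial := by
  have hi : (i.factorial : ℝ) ≠ 0 := by positivity
  have : (exp ℝ - 1) ^ i = ∑ j ∈ range (i + 1), C ((-1) ^ j * (i.choose j : ℝ)) * exp ℝ ^ (i - j) := by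
    rw [sub_eq_neg_add, add_pow]
    refine sum_congr rfl fun j _ => ?_
    simp
    ring
  rw [this, map_sum, stirling2, ← mul_assoc, mul_one_div_cancel hi, one_mul, sum_div]
  refine sum_congr rfl fun j _ => ?_
  rw [coeff_C_mul, exp_pow_eq_rescale_exp, coeff_rescale, coeff_exp]
  simp
  ring

lemma coeff_u_pow (r : ℝ) (hr : r + 1 ≠ 0) (u : PowerSeries ℝ) (hu : (exp ℝ + C r) * u = 1) (k n : ℕ) :
    coeff k (u ^ (n + 1)) = (∑ i ∈ range (k + 1), ((n + 1).ascFactorial i : ℝ) * stirling2 k i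
      * (-(1 / (r + 1))) ^ i) / ((r + 1) ^ (n + 1) * k.factorial) := by
  set b : ℝ := 1 / (r + 1) with hb
  have hbr : b * (r + 1) = 1 := by rw [hb]; field_simp
  set a : PowerSeries ℝ := C (-b) * (exp ℝ - 1) with ha
  have ha0 : constantCoeff a = 0 := by simp [ha]
  have has : HasSubst a := HasSubst.of_constantCoeff_zero' ha0
  set V : PowerSeries ℝ := PowerSeries.mk fun i => (((n + i).choose n : ℕ) : ℝ) with hV
  have hV1 : V * (1 - X) ^ (n + 1) = 1 := by
    rw [hV, ← invOneSubPow_val_succ_eq_mk_add_choose, ← invOneSubPow_inv_eq_one_sub_pow]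
    exact Units.mul_inv _
  have hV2 : subst a V * (1 - a) ^ (n + 1) = 1 := by
    have := congrArg (substAlgHom (R := ℝ) has) hV1
    rw [map_mul, map_pow, map_sub, map_one, coe_substAlgHom, subst_X has] at this
    exact this
  have h1a : exp ℝ + C r = C (r + 1) * (1 - a) := by
    have : C (r + 1) * C b = (1 : PowerSeries ℝ) := by rw [← map_mul, mul_comm, hbr, map_one]
    rw [ha, map_neg]
    calc exp ℝ + C r = C (r + 1) + 1 * (exp ℝ - 1) := by rw [map_add, map_one]; ring
      _ = C (r + 1) + (C (r + 1) * C b) * (exp ℝ - 1) := by rw [this]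
      _ = _ := by ring
  have hun : u ^ (n + 1) = C (b ^ (n + 1)) * subst a V := by
    have e : C b * C (r + 1) = (1 : PowerSeries ℝ) := by rw [← map_mul, hbr, map_one]
    rw [h1a] at hu
    rw [map_pow]
    calc u ^ (n + 1) = u ^ (n + 1) * ((C b * C (r + 1)) ^ (n + 1) * (subst a V * (1 - a) ^ (n + 1))) := by
          rw [e, hV2]; ring
      _ = C b ^ (n + 1) * subst a V * (C (r + 1) * (1 - a) * u) ^ (n + 1) := by
          simp only [mul_pow]; ring
      _ = _ := by rw [hu]; ring
  rw [hun, coeff_C_mul, coeff_subst' has, finsum_eq_sum_of_support_subset (s := range (k + 1))]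
  · rw [mul_sum, sum_div]
    refine sum_congr rfl fun i _ => ?_
    rw [hV, coeff_mk, ha, mul_pow, ← map_pow, coeff_C_mul, coeff_expm1_pow,
      Nat.ascFactorial_eq_factorial_mul_choose, hb, Nat.choose_symm_add]
    push_cast
    simp only [smul_eq_mul]
    rw [one_div_pow (r + 1) (n + 1)]
    field_simp
  · intro i hi
    by_contra hlt
    apply hi
    simp only [coe_range, Set.mem_Iio, not_lt] at hlt
    have : X ∣ a := X_dvd_iff.2 ha0
    obtain ⟨q, hq⟩ := this
    simp only [hq, mul_pow]
    rw [coeff_X_pow_mul', if_neg (by omega), smul_zero]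

end Formal

lemma hasSum_congr_pt {f g : ℕ → ℝ} {a : ℝ} (h : ∀ n, f n = g n) : HasSum f a ↔ HasSum g a := by
  rw [funext h]

section Analytic
open PowerSeries Topology Filter

def HasPS (F : ℝ → ℝ) (A : PowerSeries ℝ) : Prop :=
  ∀ᶠ z in 𝓝 (0 : ℝ), HasSum (fun n => z ^ n * coeff n A) (F z)

lemma hasPS_iff (F : ℝ → ℝ) (A : PowerSeries ℝ) :
    HasPS F A ↔ HasFPowerSeriesAt F (FormalMultilinearSeries.ofScalars ℝ fun n => coeff n A) 0 := by
  rw [hasFPowerSeriesAt_iff, HasPS]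
  simp

lemma HasPS.analyticAt {F : ℝ → ℝ} {A : PowerSeries ℝ} (h : HasPS F A) : AnalyticAt ℝ F 0 :=
  ((hasPS_iff F A).1 h).analyticAt

lemma exists_hasPS {F : ℝ → ℝ} (h : AnalyticAt ℝ F 0) : ∃ A, HasPS F A := by
  obtain ⟨p, hp⟩ := h
  rw [hasFPowerSeriesAt_iff] at hp
  refine ⟨PowerSeries.mk fun n => p.coeff n, ?_⟩
  simpa [HasPS] using hp

lemma HasPS.unique {F : ℝ → ℝ} {A B : PowerSeries ℝ} (hA : HasPS F A) (hB : HasPS F B) : A = B := by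
  have := ((hasPS_iff F A).1 hA).eq_formalMultilinearSeries ((hasPS_iff F B).1 hB)
  ext n
  have h := congrArg (fun p => FormalMultilinearSeries.coeff p n) this
  simpa using h

lemma HasPS.congr {F G : ℝ → ℝ} {A : PowerSeries ℝ} (hA : HasPS F A) (h : F =ᶠ[𝓝 0] G) : HasPS G A := by
  filter_upwards [hA, h] with z h1 h2
  rwa [← h2]

lemma HasPS.add {F G : ℝ → ℝ} {A B : PowerSeries ℝ} (hA : HasPS F A) (hB : HasPS G B) :
    HasPS (fun z => F z + G z) (A + B) := by
  filter_upwards [hA, hB] with z h1 h2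
  simpa [mul_add] using h1.add h2

lemma HasPS.mul {F G : ℝ → ℝ} {A B : PowerSeries ℝ} (hA : HasPS F A) (hB : HasPS G B) :
    HasPS (fun z => F z * G z) (A * B) := by
  filter_upwards [hA, hB] with z h1 h2
  have s1 := h1.summable.norm
  have s2 := h2.summable.norm
  have e := tsum_mul_tsum_eq_tsum_sum_antidiagonal_of_summable_norm s1 s2
  have s := (summable_norm_sum_mul_antidiagonal_of_summable_norm s1 s2).of_norm.hasSum
  rw [← e, h1.tsum_eq, h2.tsum_eq] at s
  refine (hasSum_congr_pt fun n => ?_).mpr s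
  rw [coeff_mul, mul_sum]
  refine sum_congr rfl fun p hp => ?_
  rw [← mem_antidiagonal.1 hp]
  ring

lemma hasPS_C (a : ℝ) : HasPS (fun _ => a) (C a) := by
  refine Eventually.of_forall fun z => ?_
  convert hasSum_single (f := fun n => z ^ n * coeff n (C a)) 0 ?_ using 1
  · simp
  · intro n hn
    simp [coeff_C, hn]

lemma hasPS_X : HasPS (fun z => z) X := by
  refine Eventually.of_forall fun z => ?_
  convert hasSum_single (f := fun n => z ^ n * coeff n (X : PowerSeries ℝ)) 1 ?_ using 1
  · simp
  · intro n hn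
    simp [coeff_X, hn]

lemma hasPS_exp : HasPS Real.exp (PowerSeries.exp ℝ) := by
  refine Eventually.of_forall fun z => ?_
  have := NormedSpace.expSeries_div_hasSum_exp (𝔸 := ℝ) z
  rw [← Real.exp_eq_exp_ℝ] at this
  refine (hasSum_congr_pt fun n => ?_).mpr this
  simp [coeff_exp]
  ring

lemma HasPS.pow {F : ℝ → ℝ} {A : PowerSeries ℝ} (hA : HasPS F A) (n : ℕ) :
    HasPS (fun z => F z ^ n) (A ^ n) := by
  induction n with
  | zero => simpa using hasPS_C 1
  | succ n ih => simpa [pow_succ] using ih.mul hA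

lemma hasPS_sum (F : ℕ → ℝ → ℝ) (A : ℕ → PowerSeries ℝ) (hA : ∀ i, HasPS (F i) (A i)) (n : ℕ) :
    HasPS (fun z => ∑ i ∈ range n, F i z) (∑ i ∈ range n, A i) := by
  induction n with
  | zero => simpa using hasPS_C 0
  | succ n ih => simpa [sum_range_succ] using ih.add (hA n)

lemma HasPS.tail {F : ℝ → ℝ} {A : PowerSeries ℝ} (hA : HasPS F A) (N : ℕ) :
    ∃ s : ℝ → ℝ, AnalyticAt ℝ s 0 ∧
      ∀ᶠ z in 𝓝 0, F z = ∑ m ∈ range N, coeff m A * z ^ m + z ^ N * s z := by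
  have key : ∀ᶠ z in 𝓝 (0 : ℝ), Summable (fun n => z ^ n * coeff (n + N) A) := by
    filter_upwards [hA] with z hz
    by_cases h0 : z = 0
    · subst h0
      refine summable_of_ne_finset_zero (s := {0}) fun n hn => ?_
      simp only [mem_singleton] at hn
      simp [hn]
    · have := ((summable_nat_add_iff N).2 hz.summable).mul_left ((z ^ N)⁻¹)
      refine (summable_congr fun n => ?_).mpr this
      rw [pow_add]
      field_simp
  refine ⟨fun z => ∑' n, z ^ n * coeff (n + N) A, ?_, ?_⟩
  · refine HasPS.analyticAt (A := PowerSeries.mk fun n => coeff (n + N) A) ?_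
    filter_upwards [key] with z hz
    simpa using hz.hasSum
  · filter_upwards [hA, key] with z h1 h2
    rw [← h1.tsum_eq, ← h1.summable.sum_add_tsum_nat_add N, ← tsum_mul_left]
    congr 1
    · exact sum_congr rfl fun _ _ => mul_comm _ _
    · refine tsum_congr fun n => ?_
      ring

end Analytic

/-- Taylor series of the `r`-Lambert function around `0` (for `r ≠ -1`):
`W_r(x) = x/(r+1) + ∑_{n≥2} M_{n-1}^{(n)}(1/(r+1)) x^n / ((r+1)^n n!)`; the series has
positive radius of convergence and its sum `y` solves `y e^y + r y = x`. -/
theorem rLambert_taylor (r : ℝ) (hr : r ≠ -1) :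
    ∃ ε > 0, ∀ x : ℝ, |x| < ε →
      ∃ y : ℝ,
        HasSum (fun n : ℕ =>
          if n = 0 then 0
          else if n = 1 then x / (r + 1)
          else M (n - 1) n (1 / (r + 1)) * x ^ n / ((r + 1) ^ n * (n.factorial : ℝ))) y ∧
        y * Real.exp y + r * y = x := by
  have hr1 : r + 1 ≠ 0 := fun h => hr (by linarith)
  let f : ℝ → ℝ := fun y => y * (Real.exp y + r)
  have hfPS : HasPS f (PowerSeries.X * (PowerSeries.exp ℝ + PowerSeries.C r)) :=
    hasPS_X.mul (hasPS_exp.add (hasPS_C r))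
  have hfa : AnalyticAt ℝ f 0 := hfPS.analyticAt
  have hf0 : f 0 = 0 := by simp [f]
  have hd : deriv f 0 = r + 1 := by
    have := (hasDerivAt_id (0 : ℝ)).mul ((Real.hasDerivAt_exp 0).add_const r)
    have h2 : HasDerivAt f (r + 1) 0 := by
      have e : (1 : ℝ) * (Real.exp 0 + r) + id 0 * Real.exp 0 = r + 1 := by
        simp; ring
      rw [← e]
      exact this
    exact h2.deriv
  have hd0 : deriv f 0 ≠ 0 := by rwa [hd]
  have hga := hfa.analyticAt_localInverse hd0
  have hgl := hfa.hasStrictDerivAt.eventually_left_inverse hd0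
  have hgr := hfa.hasStrictDerivAt.eventually_right_inverse hd0
  rw [hf0] at hga hgr
  generalize hfa.hasStrictDerivAt.localInverse f (deriv f 0) 0 hd0 = g at hga hgl hgr
  obtain ⟨A, hA⟩ := exists_hasPS hga
  have hu : (PowerSeries.exp ℝ + PowerSeries.C r) * (PowerSeries.exp ℝ + PowerSeries.C r)⁻¹ = 1 := by
    apply PowerSeries.mul_inv_cancel
    simp
    intro h; apply hr1; linarith
  have hc : ∀ n : ℕ, PowerSeries.coeff n ((PowerSeries.exp ℝ + PowerSeries.C r)⁻¹ ^ (n + 1))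
      = (n + 1) * PowerSeries.coeff (n + 1) A := by
    intro n
    obtain ⟨s, hs, hgs⟩ := hA.tail (n + 2)
    have hsf : AnalyticAt ℝ (fun y => s (f y)) 0 :=
      AnalyticAt.fun_comp (by rwa [hf0]) hfa
    obtain ⟨R, hR⟩ := exists_hasPS hsf
    refine lag_formal _ _ R hu (fun m => PowerSeries.coeff m A) n ?_
    refine hasPS_X.unique (HasPS.congr ((hasPS_sum (fun m y => PowerSeries.coeff m A * f y ^ m) _
      (fun m => (hasPS_C _).mul (hfPS.pow m)) (n + 2)).add ((hfPS.pow (n + 2)).mul hR)) ?_)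
    have hft : Filter.Tendsto f (nhds 0) (nhds 0) := by
      have := hfa.continuousAt.tendsto
      rwa [hf0] at this
    filter_upwards [hft.eventually hgs, hgl] with y h1 h2
    rw [← h1, h2]
  have hA0 : PowerSeries.coeff 0 A = 0 := by
    have h1 := hA.self_of_nhds
    have h2 := hgl.self_of_nhds
    rw [hf0] at h2
    rw [h2] at h1
    have h3 := hasSum_single (f := fun n => (0 : ℝ) ^ n * PowerSeries.coeff n A) 0
      (fun n hn => by simp [hn])
    have := h1.unique h3
    simpa using this.symm
  obtain ⟨ε, hε, H⟩ := Metric.eventually_nhds_iff.1 (hA.and hgr)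
  refine ⟨ε, hε, fun x hx => ?_⟩
  obtain ⟨h1, h2⟩ := H (y := x) (by simpa using hx)
  refine ⟨g x, ?_, ?_⟩
  · refine (hasSum_congr_pt fun n => ?_).mpr h1
    rcases n with _ | n
    · simp [hA0]
    · have h3 := hc n
      rw [coeff_u_pow r hr1 _ hu] at h3
      rcases n with _ | n
      · simp [stirling2] at h3
        simp [← h3]
        ring
      · have h4 : PowerSeries.coeff (n + 1 + 1) A = ((n + 1 : ℕ) + 1 : ℝ)⁻¹ *
            (((n + 1 : ℕ) + 1) * PowerSeries.coeff (n + 1 + 1) A) := by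
          have : ((n + 1 : ℕ) + 1 : ℝ) ≠ 0 := by positivity
          field_simp
        rw [if_neg (by omega), if_neg (by omega), h4, ← h3, Nat.factorial_succ (n + 1), M,
          Finset.range_eq_Ico, Finset.sum_eq_sum_Ico_succ_bot (by omega)]
        have h5 : stirling2 (n + 1) 0 = 0 := by simp [stirling2]
        rw [h5]
        simp only [mul_zero, zero_mul, zero_add]
        have h6 : Finset.Icc 1 (n + 1 + 1 - 1) = Finset.Ico 1 (n + 1 + 1) := by
          ext i; simp
        rw [h6, show n + 1 + 1 - 1 = n + 1 by omega]
        push_cast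
        field_simp
  · simp only [f] at h2
    linarith
end

section
/- Let t₁, t₂ be real numbers with t₁ ≠ t₂ and set T = t₂ - t₁. Define the power series g(a) = t₁ - ∑_{n=1}^∞ (1/(n·n!))·(a·n·e^{-t₁}/T)^n·B_{n-1}(-2/(nT)), where B_n denotes the n-th Bessel polynomial. Then g has positive radius of convergence, and for all a in some open neighborhood of 0 the sum x = g(a) satisfies e^x·(x - t₁)·(x - t₂) = a. -/
open Finset

/-- The `n`-th Bessel polynomial `B_n(z) = ∑_{k=0}^n ((n+k)!/(k! (n-k)!)) (z/2)^k`. -/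
noncomputable def besselPoly (n : ℕ) (z : ℝ) : ℝ :=
  ∑ k ∈ Finset.range (n + 1),
    ((n + k).factorial : ℝ) / ((k.factorial : ℝ) * ((n - k).factorial : ℝ)) * (z / 2) ^ k


lemma gl_inj {F : ℂ → ℂ} (hF : Differentiable ℂ F) (h0 : deriv F 0 ≠ 0) :
    ∃ R > 0, Set.InjOn F (Metric.closedBall 0 R) ∧
      ∀ z ∈ Metric.closedBall (0:ℂ) R, deriv F z ≠ 0 := by
  have hs : HasStrictDerivAt F (deriv F 0) 0 :=
    (hF.contDiff (n := 1)).contDiffAt.hasStrictDerivAt (by norm_num)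
  have h1 := (hs.hasStrictFDerivAt_equiv h0).eventually_left_inverse
  have hc : Continuous (deriv F) := (hF.contDiff (n := 1)).continuous_deriv (by norm_num)
  have h2 : ∀ᶠ z in nhds (0:ℂ), deriv F z ≠ 0 := hc.continuousAt.eventually_ne h0
  obtain ⟨R, hR, h⟩ := Metric.nhds_basis_closedBall.eventually_iff.1 (h1.and h2)
  refine ⟨R, hR, fun x hx y hy hxy => ?_, fun z hz => (h hz).2⟩
  rw [← (h hx).1, ← (h hy).1, hxy]

lemma gl_root {F : ℂ → ℂ} (hF : Differentiable ℂ F) {R : ℝ} (hR : 0 < R)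
    (hi : Set.InjOn F (Metric.closedBall 0 R))
    (hd : ∀ z ∈ Metric.closedBall (0:ℂ) R, deriv F z ≠ 0) {z₀ : ℂ}
    (hz₀ : z₀ ∈ Metric.ball (0:ℂ) R) :
    (∮ z in C(0, R), z * deriv F z / (F z - F z₀)) = (2 * Real.pi * Complex.I) * z₀ := by
  set q := dslope F z₀ with hq
  have hqd : Differentiable ℂ q := by
    rw [← differentiableOn_univ]
    exact (Complex.differentiableOn_dslope Filter.univ_mem).2 hF.differentiableOn
  have hq0 : ∀ z ∈ Metric.closedBall (0:ℂ) R, q z ≠ 0 := by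
    intro z hz
    by_cases h : z = z₀
    · subst h; rw [hq, dslope_same]; exact hd _ hz
    · rw [hq, dslope_of_ne _ h, slope_def_field]
      refine div_ne_zero (sub_ne_zero.2 fun e => h (hi hz (Metric.ball_subset_closedBall hz₀) e)) (sub_ne_zero.2 h)
  have hFq : ∀ z, F z - F z₀ = (z - z₀) * q z := by
    intro z
    have := sub_smul_dslope F z₀ z
    rw [← this, smul_eq_mul]
  have hF' : ∀ z, deriv F z = q z + (z - z₀) * deriv q z := by
    intro z
    have h1 : F = fun z => F z₀ + (z - z₀) * q z := by
      funext z; rw [← hFq]; ring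
    have h2 : HasDerivAt (fun z => F z₀ + (z - z₀) * q z) (1 * q z + (z - z₀) * deriv q z) z :=
      ((((hasDerivAt_id z).sub_const z₀).mul (hqd z).hasDerivAt)).const_add _
    conv_lhs => rw [h1]
    rw [h2.deriv, one_mul]
  have hqd' : Differentiable ℂ (deriv q) := (hqd.contDiff (n := 2)).differentiable_deriv_two
  have hr : DifferentiableOn ℂ (fun z => z * (1 + (z - z₀) * deriv q z / q z)) (Metric.closedBall 0 R) := by
    intro z hz
    refine DifferentiableAt.differentiableWithinAt ?_
    have := hqd z
    have := hqd' z
    have := hq0 z hz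
    fun_prop (disch := assumption)
  have := hr.circleIntegral_sub_inv_smul hz₀
  simp only [sub_self, zero_mul, zero_div, add_zero, mul_one, smul_eq_mul] at this
  rw [← this]
  refine circleIntegral.integral_congr hR.le fun z hz => ?_
  have hzc := Metric.sphere_subset_closedBall hz
  have hne : z - z₀ ≠ 0 := by
    rw [sub_ne_zero]; rintro rfl
    simp at hz hz₀; linarith
  have := hq0 z hzc
  simp only [hFq, hF']
  field_simp

lemma gl_series {F : ℂ → ℂ} (hF : Differentiable ℂ F) {R m : ℝ} (hR : 0 < R) (hm : 0 < m)
    (hFm : ∀ z ∈ Metric.sphere (0:ℂ) R, m ≤ ‖F z‖) {w : ℂ} (hw : ‖w‖ < m) :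
    HasSum (fun n : ℕ => ∮ z in C(0, R), (w / F z) ^ n * (z * deriv F z / F z))
      (∮ z in C(0, R), z * deriv F z / (F z - w)) := by
  have hF0 : ∀ z ∈ Metric.sphere (0:ℂ) R, F z ≠ 0 := fun z hz h => by
    have := hFm z hz; rw [h, norm_zero] at this; linarith
  have hc : Continuous (deriv F) := (hF.contDiff (n := 1)).continuous_deriv (by norm_num)
  have hFc := hF.continuous
  have hcm : ∀ θ : ℝ, circleMap 0 R θ ∈ Metric.sphere (0:ℂ) R := fun θ => circleMap_mem_sphere _ hR.le _
  have hFne : ∀ θ : ℝ, F (circleMap 0 R θ) ≠ 0 := fun θ => hF0 _ (hcm θ)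
  have hcirc : Continuous (circleMap 0 R) := continuous_circleMap 0 R
  have hcf : Continuous (fun θ : ℝ => deriv (circleMap 0 R) θ * (circleMap 0 R θ * deriv F (circleMap 0 R θ) / F (circleMap 0 R θ))) := by
    simp only [deriv_circleMap]
    fun_prop (disch := exact hFne _)
  have hr0 : 0 ≤ ‖w‖ / m := by positivity
  have hr1 : ‖w‖ / m < 1 := (div_lt_one hm).2 hw
  have hle : ∀ θ : ℝ, ‖w / F (circleMap 0 R θ)‖ ≤ ‖w‖ / m := fun θ => by
    rw [norm_div]
    exact div_le_div_of_nonneg_left (norm_nonneg _) hm (hFm _ (hcm θ))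
  refine intervalIntegral.hasSum_integral_of_dominated_convergence
      (fun n θ => ‖deriv (circleMap 0 R) θ * (circleMap 0 R θ * deriv F (circleMap 0 R θ) / F (circleMap 0 R θ))‖ * (‖w‖ / m) ^ n) (fun n => ?_) (fun n => ?_) ?_ ?_ ?_
  · refine Continuous.aestronglyMeasurable ?_
    simp only [deriv_circleMap, smul_eq_mul]
    fun_prop (disch := exact hFne _)
  · refine Filter.Eventually.of_forall fun θ _ => ?_
    rw [smul_eq_mul, mul_left_comm, norm_mul, mul_comm, norm_pow]
    exact mul_le_mul_of_nonneg_left (pow_le_pow_left₀ (norm_nonneg _) (hle θ) n) (norm_nonneg _)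
  · exact Filter.Eventually.of_forall fun _ _ => (summable_geometric_of_lt_one hr0 hr1).mul_left _
  · simp only [tsum_mul_left]
    exact (hcf.norm.mul continuous_const).intervalIntegrable _ _
  · refine Filter.Eventually.of_forall fun θ _ => HasSum.const_smul _ ?_
    have h1 : ‖w / F (circleMap 0 R θ)‖ < 1 := (hle θ).trans_lt hr1
    convert! (hasSum_geometric_of_norm_lt_one h1).mul_right _ using 1
    have h2 := hFne θ
    have h3 : F (circleMap 0 R θ) - w ≠ 0 := by
      intro h
      rw [sub_eq_zero] at h
      rw [h, div_self (h ▸ h2)] at h1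
      simp at h1
    rw [one_sub_div h2, inv_div]
    field_simp

lemma gl_parts {F : ℂ → ℂ} (hF : Differentiable ℂ F) {R : ℝ} (hR : 0 < R)
    (hF0 : ∀ z ∈ Metric.sphere (0:ℂ) R, F z ≠ 0) (n : ℕ) (hn : n ≠ 0) (w : ℂ) :
    (∮ z in C(0, R), (w / F z) ^ n * (z * deriv F z / F z)) =
      w ^ n / n * ∮ z in C(0, R), ((F z)⁻¹) ^ n := by
  have hc : Continuous (deriv F) := (hF.contDiff (n := 1)).continuous_deriv (by norm_num)
  have hFc := hF.continuous
  have hn' : (n : ℂ) ≠ 0 := by exact_mod_cast hn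
  have h0 : (∮ z in C(0, R), ((w / F z) ^ n * (z * deriv F z / F z) - w ^ n / n * ((F z)⁻¹) ^ n)) = 0 := by
    refine circleIntegral.integral_eq_zero_of_hasDerivWithinAt (f := fun z => -(w ^ n / n) * (z * ((F z)⁻¹) ^ n)) hR.le fun z hz => ?_
    have hz0 := hF0 z hz
    have := ((hasDerivAt_id z).mul (((hF z).hasDerivAt.inv hz0).pow n)).const_mul (-(w ^ n / n))
    refine HasDerivAt.hasDerivWithinAt ?_
    refine this.congr_deriv ?_
    obtain ⟨k, rfl⟩ := Nat.exists_eq_succ_of_ne_zero hn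
    simp only [id, Pi.inv_apply, Nat.succ_eq_add_one, Nat.add_sub_cancel, Pi.pow_apply, inv_pow, div_pow] at *
    field_simp
    ring
  rw [circleIntegral.integral_sub, sub_eq_zero] at h0
  · rw [h0, ← smul_eq_mul, ← circleIntegral.integral_smul]; rfl
  · refine ContinuousOn.circleIntegrable hR.le ?_
    fun_prop (disch := assumption)
  · refine ContinuousOn.circleIntegrable hR.le ?_
    fun_prop (disch := assumption)

lemma gl_prod (n k : ℕ) (x : ℂ) :
    iteratedDeriv k (fun z : ℂ => (z - x) ^ (-(n+1 : ℤ))) 0 =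
      (-1)^k * ((n + k).factorial / n.factorial) * (-x) ^ (-(n + 1 : ℤ) - k) := by
  rw [iteratedDeriv_comp_sub_const (f := fun z : ℂ => z ^ (-(n+1 : ℤ))), iteratedDeriv_eq_iterate]
  simp only [iter_deriv_zpow, zero_sub]
  congr 1
  induction k with
  | zero => simp [Nat.factorial_ne_zero]
  | succ k ih =>
    rw [prod_range_succ, ih, ← add_assoc, Nat.factorial_succ]
    push_cast
    ring

lemma gl_coeff (T : ℂ) (hT : T ≠ 0) {R : ℝ} (hR : 0 < R)
    (hTR : T ∉ Metric.closedBall (0:ℂ) R) (n : ℕ) :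
    (∮ z in C(0, R), ((Complex.exp z * z * (z - T))⁻¹) ^ (n + 1)) =
      (2 * Real.pi * Complex.I) * (- (n + 1 : ℂ) ^ n / (T ^ (n + 1) * n.factorial) *
        ∑ k ∈ range (n + 1), ((n + k).factorial : ℂ) / (k.factorial * (n - k).factorial) *
          (-1 / ((n + 1) * T)) ^ k) := by
  have hzT : ∀ z ∈ Metric.closedBall (0:ℂ) R, z - T ≠ 0 := fun z hz h => by
    rw [sub_eq_zero] at h; exact hTR (h ▸ hz)
  have hd : DifferentiableOn ℂ (fun z => (z - T) ^ (-(n+1 : ℤ)) * Complex.exp (-(n + 1) * z)) (Metric.closedBall 0 R) := by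
    intro z hz
    refine DifferentiableAt.differentiableWithinAt ?_
    have := hzT z hz
    exact DifferentiableAt.mul (DifferentiableAt.zpow (by fun_prop) (Or.inl this)) (by fun_prop)
  have := hd.circleIntegral_one_div_sub_center_pow_smul hR n
  trans (∮ z in C(0, R), (1 / (z - 0) ^ (n + 1)) • ((z - T) ^ (-(n+1 : ℤ)) * Complex.exp (-(n + 1) * z)))
  · refine circleIntegral.integral_congr hR.le fun z hz => ?_
    have h1 := hzT z (Metric.sphere_subset_closedBall hz)
    have h2 : z ≠ 0 := by rintro rfl; simp at hz; linarith
    have h3 : Complex.exp (-(n + 1) * z) = (Complex.exp z ^ (n+1))⁻¹ := by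
      rw [← Complex.exp_nat_mul, ← Complex.exp_neg]; push_cast; ring_nf
    have h4 : (z - T) ^ (-(n+1 : ℤ)) = ((z - T) ^ (n + 1))⁻¹ := by
      rw [zpow_neg]; norm_cast
    simp only [h3, h4, sub_zero, smul_eq_mul, mul_pow, inv_pow, mul_inv]
    ring
  rw [this, smul_eq_mul, div_mul_eq_mul_div, mul_div_assoc]
  congr 1
  have hcd : ContDiffAt ℂ n (fun z : ℂ => (z - T) ^ (-(n+1 : ℤ))) 0 := by
    have h4 : (fun z : ℂ => (z - T) ^ (-(n+1 : ℤ))) = fun z => ((z - T) ^ (n + 1))⁻¹ := by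
      funext z; rw [zpow_neg]; norm_cast
    rw [h4]
    refine ContDiffAt.inv (by fun_prop) ?_
    simpa using hT
  rw [iteratedDeriv_fun_mul hcd (by fun_prop), sum_div, mul_sum]
  refine sum_congr rfl fun k hk => ?_
  have hk' : k ≤ n := by simpa [Nat.lt_succ_iff] using hk
  rw [gl_prod, iteratedDeriv_cexp_const_mul, Nat.cast_choose ℂ hk']
  simp only [mul_zero, Complex.exp_zero, mul_one]
  obtain ⟨j, rfl⟩ := Nat.exists_eq_add_of_le hk'
  have h5 : (-T) ^ (-((k + j : ℕ) + 1 : ℤ) - k) = ((-T) ^ (k + j + 1 + k))⁻¹ := by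
    rw [← zpow_natCast, ← zpow_neg]; congr 1; push_cast; ring
  rw [h5]
  have f1 := Nat.factorial_ne_zero k
  have f2 := Nat.factorial_ne_zero j
  have f3 := Nat.factorial_ne_zero (k + j)
  have f4 : (k + j + 1 : ℂ) ≠ 0 := by exact_mod_cast Nat.succ_ne_zero (k + j)
  simp only [Nat.add_sub_cancel_left]
  push_cast
  rw [neg_pow T, neg_pow (k + j + 1 : ℂ), div_pow, mul_pow]
  have e : ((-1:ℂ) ^ (k + j + 1 + k))⁻¹ = - (-1) ^ (k + j) * (-1)^k := by
    rw [← inv_pow]; norm_num; ring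
  rw [mul_inv, e]
  have e2 : ((-1:ℂ) ^ k) ^ 2 = 1 := by rw [← pow_mul, mul_comm, pow_mul]; norm_num
  have e3 : ((-1:ℂ) ^ j) ^ 2 = 1 := by rw [← pow_mul, mul_comm, pow_mul]; norm_num
  field_simp
  ring_nf
  simp [pow_mul, e2, e3]

/-- Mugnaini's theorem: the Taylor series of the generalized Lambert function
`W(t₁,t₂;;a)` around `a = 0` is
`t₁ - ∑_{n≥1} (1/(n n!)) (a n e^{-t₁}/T)^n B_{n-1}(-2/(nT))` where `T = t₂ - t₁`; it has
positive radius of convergence and its sum `x` solves `e^x (x - t₁)(x - t₂) = a`. -/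
theorem genLambert_two_upper_taylor (t₁ t₂ : ℝ) (h : t₁ ≠ t₂) :
    ∃ ε > 0, ∀ a : ℝ, |a| < ε →
      ∃ x : ℝ,
        HasSum (fun n : ℕ =>
          if n = 0 then t₁
          else -(1 / ((n : ℝ) * (n.factorial : ℝ))) *
            (a * (n : ℝ) * Real.exp (-t₁) / (t₂ - t₁)) ^ n *
            besselPoly (n - 1) (-2 / ((n : ℝ) * (t₂ - t₁)))) x ∧
        Real.exp x * (x - t₁) * (x - t₂) = a := by
  obtain ⟨T, hT⟩ : ∃ T, T = t₂ - t₁ := ⟨_, rfl⟩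
  have hT0 : T ≠ 0 := by rw [hT]; exact sub_ne_zero.2 h.symm
  have hTc : (T : ℂ) ≠ 0 := by exact_mod_cast hT0
  rw [← hT]
  set F : ℂ → ℂ := fun z => Complex.exp z * z * (z - T) with hFdef
  have hF : Differentiable ℂ F := by rw [hFdef]; fun_prop
  have hF0 : F 0 = 0 := by simp [hFdef]
  have hFT : F T = 0 := by simp [hFdef]
  have hd0 : deriv F 0 ≠ 0 := by
    have h1 := ((Complex.hasDerivAt_exp 0).mul (hasDerivAt_id (0:ℂ))).mul
      ((hasDerivAt_id (0:ℂ)).sub_const (T:ℂ))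
    have h2 : HasDerivAt F (-T) 0 := by
      refine h1.congr_deriv ?_
      simp
    rw [h2.deriv]; simpa using hTc
  obtain ⟨R, hR, hinj, hder⟩ := gl_inj hF hd0
  have h0mem : (0:ℂ) ∈ Metric.closedBall (0:ℂ) R := by simp [hR.le]
  have hTR : (T:ℂ) ∉ Metric.closedBall (0:ℂ) R := fun hm =>
    hTc (hinj hm h0mem (hFT.trans hF0.symm))
  have hFne : ∀ z ∈ Metric.sphere (0:ℂ) R, F z ≠ 0 := fun z hz e => by
    have : z = 0 := hinj (Metric.sphere_subset_closedBall hz) h0mem (e.trans hF0.symm)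
    subst this; simp at hz; linarith
  obtain ⟨m, hm, hFm⟩ : ∃ m > 0, ∀ z ∈ Metric.sphere (0:ℂ) R, m ≤ ‖F z‖ := by
    obtain ⟨z, hz, hz'⟩ := (isCompact_sphere (0:ℂ) R).exists_isMinOn
      (NormedSpace.sphere_nonempty.2 hR.le) hF.continuous.norm.continuousOn
    exact ⟨‖F z‖, norm_pos_iff.2 (hFne z hz), fun y hy => hz' hy⟩
  have hroot : ∀ᶠ b in nhds (0:ℝ), ∃ y : ℝ, |y| < R ∧ Real.exp y * y * (y - T) = b := by
    have hs : HasStrictDerivAt (fun y : ℝ => Real.exp y * y * (y - T)) (-T) 0 := by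
      have h1 := ((Real.hasStrictDerivAt_exp 0).mul (hasStrictDerivAt_id (0:ℝ))).mul
        ((hasStrictDerivAt_id (0:ℝ)).sub_const T)
      refine h1.congr_deriv ?_
      simp
    have h2 := hs.map_nhds_eq (neg_ne_zero.2 hT0)
    simp only [mul_zero, zero_mul] at h2
    rw [← h2, Filter.eventually_map]
    filter_upwards [Metric.ball_mem_nhds (0:ℝ) hR] with y hy
    exact ⟨y, by simpa using hy, rfl⟩
  have hlim : Filter.Tendsto (fun a : ℝ => a * Real.exp (-t₁)) (nhds 0) (nhds 0) := by
    have : Continuous (fun a : ℝ => a * Real.exp (-t₁)) := by fun_prop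
    simpa using this.tendsto 0
  have hev := hlim.eventually (hroot.and (Metric.ball_mem_nhds (0:ℝ) hm))
  obtain ⟨ε, hε, H⟩ := Metric.eventually_nhds_iff.1 hev
  refine ⟨ε, hε, fun a ha => ?_⟩
  obtain ⟨⟨y, hyR, hy⟩, hb⟩ := H (y := a) (by simpa using ha)
  obtain ⟨b, hbdef⟩ : ∃ b, b = a * Real.exp (-t₁) := ⟨_, rfl⟩
  rw [← hbdef] at hy hb
  have hbm : ‖(b:ℂ)‖ < m := by simpa using hb
  have hFy : F y = b := by rw [← hy]; simp [hFdef]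
  refine ⟨t₁ + y, ?_, ?_⟩
  · have hyb : (y:ℂ) ∈ Metric.ball (0:ℂ) R := by simpa using hyR
    have hS := gl_series hF hR hm hFm hbm
    rw [← hFy, gl_root hF hR hinj hder hyb, hFy] at hS
    have hS2 := hS.mul_left (2 * Real.pi * Complex.I)⁻¹
    rw [inv_mul_cancel_left₀ Complex.two_pi_I_ne_zero] at hS2
    have hS3 : HasSum (fun n : ℕ => if n = 0 then (0:ℝ) else -(1 / ((n : ℝ) * (n.factorial : ℝ))) *
            (a * (n : ℝ) * Real.exp (-t₁) / T) ^ n *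
            besselPoly (n - 1) (-2 / ((n : ℝ) * T))) y := by
      rw [← Complex.hasSum_ofReal]
      convert! hS2 using 1
      funext n
      rcases n with _ | n
      · have := gl_root hF hR hinj hder (z₀ := 0) (by simpa using hR)
        rw [hF0] at this
        simp only [sub_zero, mul_zero] at this
        simp [this]
      · rw [gl_parts hF hR hFne (n + 1) (Nat.succ_ne_zero n), hFdef, gl_coeff (T:ℂ) hTc hR hTR n,
          mul_left_comm, inv_mul_cancel_left₀ Complex.two_pi_I_ne_zero]
        have e1 : a * ((n + 1 : ℕ) : ℝ) * Real.exp (-t₁) / T = b * (n + 1) / T := by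
          rw [hbdef]; push_cast; ring
        have f4 : (n + 1 : ℂ) ≠ 0 := by exact_mod_cast Nat.succ_ne_zero n
        have f3 : (n.factorial : ℂ) ≠ 0 := by exact_mod_cast Nat.factorial_ne_zero n
        have e2 : ((besselPoly n (-2 / (((n + 1 : ℕ) : ℝ) * T)) : ℝ) : ℂ) =
          ∑ k ∈ range (n + 1), ((n + k).factorial : ℂ) / (k.factorial * (n - k).factorial) *
            (-1 / ((n + 1) * T)) ^ k := by
          rw [besselPoly]
          push_cast
          refine sum_congr rfl fun k _ => ?_
          congr 2
          field_simp
        rw [if_neg (Nat.succ_ne_zero n), Nat.add_sub_cancel, e1, ← e2, Nat.factorial_succ]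
        push_cast
        rw [div_pow, mul_pow]
        field_simp
        ring
    convert! (hasSum_ite_eq 0 t₁).add hS3 using 1
    funext n
    split_ifs <;> simp
  · have : Real.exp (t₁ + y) * (t₁ + y - t₁) * (t₁ + y - t₂) = Real.exp t₁ * b := by
      rw [← hy, Real.exp_add, hT]; ring
    rw [this, hbdef, mul_left_comm, ← Real.exp_add]; simp
end
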